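/- Let g and ḡ be projectively equivalent Riemannian metrics on a 2-dimensional manifold, with Ricci tensors R_{ij} and R̄_{ij} and Levi-Civita covariant derivatives denoted by a comma. Then the (0,3)-tensor L_{ijk} := R_{ij,k} − R_{ik,j} is the same for both metrics: R̄_{ij,k} − R̄_{ik,j} = R_{ij,k} − R_{ik,j}. In other words, in dimension 2 the Liouville tensor L is, in the metric case, a tensor invariant of the projective structure. -/

import Mathlib

open scoped ContDiff

noncomputable section

namespace ProjGeo

/-- The partial derivative of a function on `ℝⁿ` in the `j`-th coordinate direction. -/
def pd {n : ℕ} (j : Fin n) (f : (Fin n → ℝ) → ℝ) (p : Fin n → ℝ) : ℝ :=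
  fderiv ℝ f p (Pi.single j 1)

/-- Christoffel symbols in coordinates: `Γ p i j k` represents `Γ^i_{jk}` at the point `p`. -/
abbrev Christoffel (n : ℕ) := (Fin n → ℝ) → Fin n → Fin n → Fin n → ℝ

/-- A connection is torsion-free (symmetric) if `Γ^i_{jk} = Γ^i_{kj}`. -/
def TorsionFree {n : ℕ} (Γ : Christoffel n) : Prop :=
  ∀ p i j k, Γ p i j k = Γ p i k j

/-- Smoothness of the Christoffel symbols on the open set `U`. -/
def SmoothChristoffelOn {n : ℕ} (U : Set (Fin n → ℝ)) (Γ : Christoffel n) : Prop :=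
  ∀ i j k, ContDiffOn ℝ ∞ (fun p => Γ p i j k) U

/-- `γ` is a (parameterized) geodesic of the connection `Γ` on the parameter set `I`,
staying inside `U`: it is smooth and satisfies `γ̈^i + Γ^i_{jk} γ̇^j γ̇^k = 0`. -/
def IsGeodesicOn {n : ℕ} (U : Set (Fin n → ℝ)) (Γ : Christoffel n)
    (γ : ℝ → Fin n → ℝ) (I : Set ℝ) : Prop :=
  (∀ t ∈ I, γ t ∈ U) ∧ (∀ i, ContDiffOn ℝ ∞ (fun t => γ t i) I) ∧
  ∀ t ∈ I, ∀ i,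
    deriv (fun s => deriv (fun u => γ u i) s) t
      + ∑ j, ∑ k, Γ (γ t) i j k * deriv (fun u => γ u j) t * deriv (fun u => γ u k) t = 0

/-- `h` is a smooth regular reparameterisation defined on `J` and mapping `J` bijectively
onto `I`. -/
def IsReparam (I J : Set ℝ) (h : ℝ → ℝ) : Prop :=
  ContDiffOn ℝ ∞ h J ∧ (∀ t ∈ J, deriv h t ≠ 0) ∧ Set.BijOn h J I

/-- Two connections are projectively equivalent on `U`: each geodesic of the one is, after a
suitable reparameterisation, a geodesic of the other, and vice versa. -/
def ProjEquivOn {n : ℕ} (U : Set (Fin n → ℝ)) (Γ Γ' : Christoffel n) : Prop :=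
  (∀ γ I, IsOpen I → IsGeodesicOn U Γ γ I →
    ∃ h J, IsOpen J ∧ IsReparam I J h ∧ IsGeodesicOn U Γ' (fun t => γ (h t)) J) ∧
  (∀ γ I, IsOpen I → IsGeodesicOn U Γ' γ I →
    ∃ h J, IsOpen J ∧ IsReparam I J h ∧ IsGeodesicOn U Γ (fun t => γ (h t)) J)

/-- `Γ'` is obtained from `Γ` by the projective change associated with the 1-form `φ`:
`Γ'^i_{jk} = Γ^i_{jk} + φ_k δ^i_j + φ_j δ^i_k` on `U`. -/
def ProjChange {n : ℕ} (Γ Γ' : Christoffel n) (φ : (Fin n → ℝ) → Fin n → ℝ)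
    (U : Set (Fin n → ℝ)) : Prop :=
  ∀ p ∈ U, ∀ i j k, Γ' p i j k =
    Γ p i j k + (if i = j then φ p k else 0) + (if i = k then φ p j else 0)

end ProjGeo

namespace ProjGeo

/-- The covariant derivative `K_{ij,k}` of a `(0,2)`-tensor `K` of projective weight `w`
(in the local trivialization of `(Λₙ)^{w/(n+1)}` by `(dx¹∧⋯∧dxⁿ)^{w/(n+1)}`):
`K_{ij,k} = ∂_k K_{ij} − Γ^s_{ik} K_{sj} − Γ^s_{jk} K_{is} − (w/(n+1)) Γ^s_{sk} K_{ij}`. -/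
def covForm2 {n : ℕ} (w : ℝ) (Γ : Christoffel n) (K : (Fin n → ℝ) → Fin n → Fin n → ℝ)
    (p : Fin n → ℝ) (i j k : Fin n) : ℝ :=
  pd k (fun q => K q i j) p - ∑ s, Γ p s i k * K p s j - ∑ s, Γ p s j k * K p i s
    - (w / ((n : ℝ) + 1)) * (∑ s, Γ p s s k) * K p i j

end ProjGeo

namespace ProjGeo

/-- A (pseudo-Riemannian) metric on `U` in coordinates: a smooth symmetric nondegenerate
matrix-valued function. -/
def MetricOn {n : ℕ} (U : Set (Fin n → ℝ))
    (g : (Fin n → ℝ) → Matrix (Fin n) (Fin n) ℝ) : Prop :=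
  (∀ i j, ContDiffOn ℝ ∞ (fun p => g p i j) U) ∧
  (∀ p ∈ U, ∀ i j, g p i j = g p j i) ∧
  (∀ p ∈ U, (g p).det ≠ 0)

/-- A Riemannian (positive definite) metric on `U` in coordinates. -/
def RiemannianOn {n : ℕ} (U : Set (Fin n → ℝ))
    (g : (Fin n → ℝ) → Matrix (Fin n) (Fin n) ℝ) : Prop :=
  MetricOn U g ∧
  ∀ p ∈ U, ∀ v : Fin n → ℝ, v ≠ 0 → 0 < ∑ i, ∑ j, g p i j * v i * v j

/-- The Christoffel symbols of the Levi-Civita connection of the metric `g`: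
`Γ^i_{jk} = ½ g^{is} (∂_j g_{sk} + ∂_k g_{sj} − ∂_s g_{jk})`. -/
def LeviCivita {n : ℕ} (g : (Fin n → ℝ) → Matrix (Fin n) (Fin n) ℝ) : Christoffel n :=
  fun p i j k => (1 / 2) * ∑ s, (g p)⁻¹ i s *
    (pd j (fun q => g q s k) p + pd k (fun q => g q s j) p - pd s (fun q => g q j k) p)

end ProjGeo

namespace ProjGeo

/-- The curvature tensor `R^h_{ijk}` of the connection `Γ`:
`R^h_{ijk} = ∂_j Γ^h_{ik} − ∂_k Γ^h_{ij} + Γ^a_{ik} Γ^h_{aj} − Γ^a_{ij} Γ^h_{ak}`. -/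
def curv {n : ℕ} (Γ : Christoffel n) (p : Fin n → ℝ) (h i j k : Fin n) : ℝ :=
  pd j (fun q => Γ q h i k) p - pd k (fun q => Γ q h i j) p
    + ∑ a, Γ p a i k * Γ p h a j - ∑ a, Γ p a i j * Γ p h a k

/-- The Ricci tensor `R_{ij} = R^s_{isj}` of the connection `Γ`. -/
def ric {n : ℕ} (Γ : Christoffel n) (p : Fin n → ℝ) (i j : Fin n) : ℝ :=
  ∑ s, curv Γ p s i s j

end ProjGeo

namespace ProjGeo

/-- The Liouville tensor `L_{ijk} = R_{ij,k} − R_{ik,j}` of a metric `g` (Ricci tensor of the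
Levi-Civita connection, covariantly differentiated by the Levi-Civita connection). -/
def liouville (g : (Fin 2 → ℝ) → Matrix (Fin 2) (Fin 2) ℝ)
    (p : Fin 2 → ℝ) (i j k : Fin 2) : ℝ :=
  covForm2 0 (LeviCivita g) (fun q => ric (LeviCivita g) q) p i j k
    - covForm2 0 (LeviCivita g) (fun q => ric (LeviCivita g) q) p i k j

open scoped Topology

/-- An autonomous ODE with a smooth right-hand side on an open set has a smooth local solution
through every point of that set. -/
theorem exists_smooth_integralCurve {E : Type*} [NormedAddCommGroup E] [NormedSpace ℝ E]
    [CompleteSpace E] {F : E → E} {V : Set E} (hV : IsOpen V) (hF : ContDiffOn ℝ ∞ F V)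
    {x₀ : E} (hx₀ : x₀ ∈ V) :
    ∃ α : ℝ → E, α 0 = x₀ ∧ ∃ δ > (0 : ℝ), ContDiffOn ℝ ∞ α (Set.Ioo (-δ) δ) ∧
      ∀ t ∈ Set.Ioo (-δ) δ, α t ∈ V ∧ HasDerivAt α (F (α t)) t := by
  have hF1 : ContDiffAt ℝ 1 F x₀ :=
    (hF.contDiffAt (hV.mem_nhds hx₀)).of_le (by exact_mod_cast le_top)
  obtain ⟨α, hα0, ε, hε, hα⟩ :=
    hF1.exists_forall_mem_closedBall_exists_eq_forall_mem_Ioo_hasDerivAt₀ 0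
  simp only [zero_sub, zero_add] at hα
  have hmem : ∀ᶠ t in 𝓝 (0 : ℝ), α t ∈ V :=
    (hα 0 ⟨by linarith, hε⟩).continuousAt.eventually_mem (hV.mem_nhds (hα0 ▸ hx₀))
  obtain ⟨η, hη, hball⟩ := Metric.eventually_nhds_iff.mp hmem
  set δ := min ε η / 2 with hδ
  have hpos : 0 < min ε η := lt_min hε hη
  have h1 : min ε η ≤ ε := min_le_left _ _
  have h2 : min ε η ≤ η := min_le_right _ _
  have hIcc : ∀ t ∈ Set.Icc (-δ) δ, α t ∈ V ∧ HasDerivAt α (F (α t)) t := by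
    intro t ht
    refine ⟨hball ?_, hα t ⟨by linarith [ht.1], by linarith [ht.2]⟩⟩
    rw [Real.dist_eq, sub_zero, abs_lt]
    exact ⟨by linarith [ht.1], by linarith [ht.2]⟩
  refine ⟨α, hα0, δ, by positivity, ?_, fun t ht => hIcc t (Set.Ioo_subset_Icc_self ht)⟩
  refine ContDiffOn.mono ?_ Set.Ioo_subset_Icc_self
  refine ODE.contDiffOn_enat_Icc_of_hasDerivWithinAt (n := ⊤) (f := fun _ => F) (u := V) ?_
    (fun t ht => (hIcc t ht).2.hasDerivWithinAt) (fun t ht => (hIcc t ht).1)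
  exact hF.comp contDiffOn_snd (fun x hx => hx.2)

/-- Through every point there is a geodesic with prescribed initial velocity. -/
theorem exists_geodesic {n : ℕ} {U : Set (Fin n → ℝ)} (hU : IsOpen U) {Γ : Christoffel n}
    (hΓ : SmoothChristoffelOn U Γ) {p : Fin n → ℝ} (hp : p ∈ U) (v : Fin n → ℝ) :
    ∃ γ I, IsOpen I ∧ (0 : ℝ) ∈ I ∧ IsGeodesicOn U Γ γ I ∧ γ 0 = p ∧
      ∀ i, deriv (fun u => γ u i) 0 = v i := by
  set F : (Fin n → ℝ) × (Fin n → ℝ) → (Fin n → ℝ) × (Fin n → ℝ) :=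
    fun z => (z.2, fun i => -∑ j, ∑ k, Γ z.1 i j k * z.2 j * z.2 k) with hF
  have hFs : ContDiffOn ℝ ∞ F (U ×ˢ Set.univ) := by
    refine contDiffOn_snd.prodMk (contDiffOn_pi.2 fun i => ContDiffOn.neg ?_)
    refine ContDiffOn.sum fun j _ => ContDiffOn.sum fun k _ => ?_
    have hz : ∀ l, ContDiffOn ℝ ∞ (fun z : (Fin n → ℝ) × (Fin n → ℝ) => z.2 l)
        (U ×ˢ Set.univ) := fun l => by fun_prop
    exact (((hΓ i j k).comp contDiffOn_fst (fun z hz => hz.1)).mul (hz j)).mul (hz k)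
  obtain ⟨α, hα0, δ, hδ, hαs, hα⟩ :=
    exists_smooth_integralCurve (hU.prod isOpen_univ) hFs (x₀ := (p, v)) ⟨hp, trivial⟩
  have hd1 : ∀ t ∈ Set.Ioo (-δ) δ, ∀ i, HasDerivAt (fun u => (α u).1 i) ((α t).2 i) t :=
    fun t ht i => (hasDerivAt_pi.1 (hα t ht).2.fst) i
  have hd2 : ∀ t ∈ Set.Ioo (-δ) δ, ∀ i, HasDerivAt (fun u => (α u).2 i)
      (-∑ j, ∑ k, Γ (α t).1 i j k * (α t).2 j * (α t).2 k) t :=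
    fun t ht i => (hasDerivAt_pi.1 (hα t ht).2.snd) i
  have h0 : (0 : ℝ) ∈ Set.Ioo (-δ) δ := ⟨by linarith, hδ⟩
  refine ⟨fun t => (α t).1, Set.Ioo (-δ) δ, isOpen_Ioo, h0, ⟨fun t ht => (hα t ht).1.1,
    fun i => (contDiffOn_pi.1 hαs.fst) i, fun t ht i => ?_⟩, by simp [hα0], fun i => ?_⟩
  · have hev : (fun s => deriv (fun u => (α u).1 i) s) =ᶠ[𝓝 t] fun s => (α s).2 i := by
      filter_upwards [isOpen_Ioo.mem_nhds ht] with s hs using (hd1 s hs i).deriv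
    rw [hev.deriv_eq, (hd2 t ht i).deriv]
    simp only [(hd1 t ht _).deriv]
    ring
  · rw [(hd1 0 h0 i).deriv, hα0]

/-- If the geodesics of `Γ` are, up to reparameterisation, geodesics of `Γ'`, then at each point
the quadratic map `v ↦ (Γ' - Γ)(v, v)` takes every vector to a multiple of itself. -/
theorem exists_christoffel_diff_eq_smul {n : ℕ} {U : Set (Fin n → ℝ)} (hU : IsOpen U)
    {Γ Γ' : Christoffel n} (hΓ : SmoothChristoffelOn U Γ) (h : ProjEquivOn U Γ Γ')
    {p : Fin n → ℝ} (hp : p ∈ U) (v : Fin n → ℝ) :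
    ∃ c : ℝ, ∀ i, ∑ j, ∑ k, (Γ' p i j k - Γ p i j k) * v j * v k = c * v i := by
  obtain ⟨γ, I, hI, h0, hγ, hγ0, hγv⟩ := exists_geodesic hU hΓ hp v
  obtain ⟨h, J, hJ, ⟨hs, hne, hbij⟩, hgeo⟩ := h.1 γ I hI hγ
  obtain ⟨t, ht, ht0⟩ := hbij.surjOn h0
  have hdh : ∀ s ∈ J, HasDerivAt h (deriv h s) s := fun s hsJ =>
    ((hs.differentiableOn (by simp)).differentiableAt (hJ.mem_nhds hsJ)).hasDerivAt
  have hdγ : ∀ i, ∀ s ∈ I, HasDerivAt (fun u => γ u i) (deriv (fun u => γ u i) s) s :=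
    fun i s hsI => (((hγ.2.1 i).differentiableOn (by simp)).differentiableAt
      (hI.mem_nhds hsI)).hasDerivAt
  have hddh : HasDerivAt (deriv h) (deriv (deriv h) t) t :=
    ((((contDiffOn_infty_iff_deriv_of_isOpen hJ).1 hs).2.differentiableOn
      (by simp)).differentiableAt (hJ.mem_nhds ht)).hasDerivAt
  have hddγ : ∀ i, HasDerivAt (deriv fun u => γ u i) (deriv (deriv fun u => γ u i) (h t)) (h t) :=
    fun i => ((((contDiffOn_infty_iff_deriv_of_isOpen hI).1 (hγ.2.1 i)).2.differentiableOn
      (by simp)).differentiableAt (hI.mem_nhds (ht0 ▸ h0))).hasDerivAt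
  have hc : ∀ i, ∀ s ∈ J,
      deriv (fun u => γ (h u) i) s = deriv (fun u => γ u i) (h s) * deriv h s :=
    fun i s hsJ => ((hdγ i (h s) (hbij.mapsTo hsJ)).comp s (hdh s hsJ)).deriv
  have hcc : ∀ i, deriv (fun s => deriv (fun u => γ (h u) i) s) t =
      deriv (deriv fun u => γ u i) (h t) * deriv h t * deriv h t
        + deriv (fun u => γ u i) (h t) * deriv (deriv h) t := by
    intro i
    have hev : (fun s => deriv (fun u => γ (h u) i) s) =ᶠ[𝓝 t]
        fun s => deriv (fun u => γ u i) (h s) * deriv h s := by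
      filter_upwards [hJ.mem_nhds ht] with s hsJ using hc i s hsJ
    rw [hev.deriv_eq]
    exact (((hddγ i).comp t (hdh t ht)).mul hddh).deriv
  refine ⟨-deriv (deriv h) t / (deriv h t) ^ 2, fun i => ?_⟩
  have e1 := hγ.2.2 0 h0 i
  have e2 := hgeo.2.2 t ht i
  simp only [hcc, hc _ t ht, ht0, hγv, hγ0] at e1 e2
  have hn := hne t ht
  have e3 : ∑ j, ∑ k, Γ' p i j k * (v j * deriv h t) * (v k * deriv h t)
      = (∑ j, ∑ k, Γ' p i j k * v j * v k) * (deriv h t) ^ 2 := by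
    simp only [Finset.sum_mul]
    exact Finset.sum_congr rfl fun j _ => Finset.sum_congr rfl fun k _ => by ring
  rw [e3] at e2
  simp only [sub_mul, Finset.sum_sub_distrib]
  field_simp
  linear_combination e2 - (deriv h t) ^ 2 * e1

/-- In dimension two, a symmetric bilinear vector-valued map `D` for which `D(v, v)` is always a
multiple of `v` has the form `φ_k δ^i_j + φ_j δ^i_k`. -/
theorem projective_form_of_forall_smul {D : Fin 2 → Fin 2 → Fin 2 → ℝ}
    (hsymm : ∀ i, D i 1 0 = D i 0 1)
    (hD : ∀ v : Fin 2 → ℝ, ∃ c : ℝ, ∀ i, ∑ j, ∑ k, D i j k * v j * v k = c * v i) :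
    D 0 0 0 = 2 * D 1 0 1 ∧ D 1 1 1 = 2 * D 0 0 1 ∧ D 0 1 1 = 0 ∧ D 1 0 0 = 0 := by
  have key : ∀ x y : ℝ, (D 0 0 0 * x * x + 2 * D 0 0 1 * x * y + D 0 1 1 * y * y) * y =
      (D 1 0 0 * x * x + 2 * D 1 0 1 * x * y + D 1 1 1 * y * y) * x := by
    intro x y
    obtain ⟨c, hc⟩ := hD ![x, y]
    have h0 := hc 0
    have h1 := hc 1
    simp [Fin.sum_univ_two, hsymm] at h0 h1
    linear_combination y * h0 - x * h1
  have k1 := key 1 0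
  have k2 := key 0 1
  have k3 := key 1 1
  have k4 := key 1 (-1)
  norm_num at k1 k2 k3 k4
  refine ⟨?_, ?_, ?_, ?_⟩ <;> linarith

theorem pd_congr {n : ℕ} {U : Set (Fin n → ℝ)} (hU : IsOpen U) {f f' : (Fin n → ℝ) → ℝ}
    (h : ∀ q ∈ U, f q = f' q) {p : Fin n → ℝ} (hp : p ∈ U) (j : Fin n) :
    pd j f p = pd j f' p := by
  have hev : f =ᶠ[𝓝 p] f' := by
    filter_upwards [hU.mem_nhds hp] with q hq using h q hq
  rw [pd, pd, hev.fderiv_eq]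

theorem contDiffOn_pd {n : ℕ} {U : Set (Fin n → ℝ)} (hU : IsOpen U) {f : (Fin n → ℝ) → ℝ}
    (hf : ContDiffOn ℝ ∞ f U) (j : Fin n) : ContDiffOn ℝ ∞ (pd j f) U :=
  ((contDiffOn_infty_iff_fderiv_of_isOpen hU).1 hf).2.clm_apply contDiffOn_const

theorem differentiableAt_of_contDiffOn {n : ℕ} {U : Set (Fin n → ℝ)} (hU : IsOpen U)
    {f : (Fin n → ℝ) → ℝ} (hf : ContDiffOn ℝ ∞ f U) {p : Fin n → ℝ} (hp : p ∈ U) :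
    DifferentiableAt ℝ f p :=
  (hf.differentiableOn (by simp)).differentiableAt (hU.mem_nhds hp)

theorem pd_comm {n : ℕ} {U : Set (Fin n → ℝ)} (hU : IsOpen U) {f : (Fin n → ℝ) → ℝ}
    (hf : ContDiffOn ℝ ∞ f U) {p : Fin n → ℝ} (hp : p ∈ U) (i j : Fin n) :
    pd i (pd j f) p = pd j (pd i f) p := by
  have hd : DifferentiableAt ℝ (fderiv ℝ f) p :=
    (((contDiffOn_infty_iff_fderiv_of_isOpen hU).1 hf).2.differentiableOn
      (by simp)).differentiableAt (hU.mem_nhds hp)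
  have hpd : ∀ k l : Fin n,
      pd k (pd l f) p = fderiv ℝ (fderiv ℝ f) p (Pi.single k 1) (Pi.single l 1) := by
    intro k l
    have := (hd.hasFDerivAt.clm_apply (hasFDerivAt_const (Pi.single l (1 : ℝ)) p)).fderiv
    change fderiv ℝ (fun q => fderiv ℝ f q (Pi.single l 1)) p (Pi.single k 1) = _
    rw [this]
    simp
  rw [hpd, hpd]
  exact (hf.contDiffAt (hU.mem_nhds hp)).isSymmSndFDerivAt
    (by rw [minSmoothness_of_isRCLikeNormedField]; exact WithTop.coe_le_coe.2 le_top) _ _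

section

variable {n : ℕ} {f f' : (Fin n → ℝ) → ℝ} {p : Fin n → ℝ}

theorem pd_add (hf : DifferentiableAt ℝ f p) (hf' : DifferentiableAt ℝ f' p) (j : Fin n) :
    pd j (fun q => f q + f' q) p = pd j f p + pd j f' p := by
  simp only [pd, fderiv_fun_add hf hf', add_apply]

theorem pd_sub (hf : DifferentiableAt ℝ f p) (hf' : DifferentiableAt ℝ f' p) (j : Fin n) :
    pd j (fun q => f q - f' q) p = pd j f p - pd j f' p := by
  simp only [pd, fderiv_fun_sub hf hf', sub_apply]

theorem pd_mul (hf : DifferentiableAt ℝ f p) (hf' : DifferentiableAt ℝ f' p) (j : Fin n) :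
    pd j (fun q => f q * f' q) p = f p * pd j f' p + f' p * pd j f p := by
  simp only [pd, fderiv_fun_mul hf hf', add_apply,
    smul_apply, smul_eq_mul]

theorem pd_log (hf : DifferentiableAt ℝ f p) (h0 : f p ≠ 0) (j : Fin n) :
    pd j (fun q => Real.log (f q)) p = (f p)⁻¹ * pd j f p := by
  simp only [pd, fderiv.log hf h0, smul_apply, smul_eq_mul]

theorem pd_zero (j : Fin n) : pd j (fun _ => 0) p = 0 := by
  simp [pd]

end

section

variable {U : Set (Fin 2 → ℝ)} {g : (Fin 2 → ℝ) → Matrix (Fin 2) (Fin 2) ℝ}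

theorem MetricOn.contDiffOn_det (hg : MetricOn U g) : ContDiffOn ℝ ∞ (fun q => (g q).det) U := by
  simp only [Matrix.det_fin_two]
  exact ((hg.1 0 0).mul (hg.1 1 1)).sub ((hg.1 0 1).mul (hg.1 1 0))

theorem MetricOn.contDiffOn_inv (hg : MetricOn U g) (i j : Fin 2) :
    ContDiffOn ℝ ∞ (fun q => (g q)⁻¹ i j) U := by
  have hdet := hg.contDiffOn_det.inv hg.2.2
  simp only [Matrix.inv_def, Matrix.adjugate_fin_two, Matrix.smul_apply, Ring.inverse_eq_inv',
    smul_eq_mul]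
  refine hdet.mul ?_
  fin_cases i <;> fin_cases j
  · exact hg.1 1 1
  · exact (hg.1 0 1).neg
  · exact (hg.1 1 0).neg
  · exact hg.1 0 0

theorem MetricOn.smooth_leviCivita (hU : IsOpen U) (hg : MetricOn U g) :
    SmoothChristoffelOn U (LeviCivita g) := by
  intro i j k
  refine contDiffOn_const.mul (ContDiffOn.sum fun s _ => (hg.contDiffOn_inv i s).mul ?_)
  exact ((contDiffOn_pd hU (hg.1 s k) j).add (contDiffOn_pd hU (hg.1 s j) k)).sub
    (contDiffOn_pd hU (hg.1 j k) s)

theorem MetricOn.leviCivita_symm (hU : IsOpen U) (hg : MetricOn U g) {p : Fin 2 → ℝ} (hp : p ∈ U)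
    (i j k : Fin 2) : LeviCivita g p i j k = LeviCivita g p i k j := by
  simp only [LeviCivita]
  congr 1
  refine Finset.sum_congr rfl fun s _ => ?_
  rw [pd_congr hU (fun q hq => hg.2.1 q hq j k) hp]
  ring

/-- The contracted Christoffel symbols of a metric are the derivatives of `½ log |det g|`. -/
theorem MetricOn.sum_leviCivita (hU : IsOpen U) (hg : MetricOn U g) {p : Fin 2 → ℝ} (hp : p ∈ U)
    (k : Fin 2) :
    ∑ s, LeviCivita g p s s k = (1 / 2) * pd k (fun q => Real.log (g q).det) p := by
  have hd := fun i j => differentiableAt_of_contDiffOn hU (hg.1 i j) hp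
  have hsymm := fun l => pd_congr hU (fun q hq => hg.2.1 q hq 1 0) hp l
  rw [pd_log (differentiableAt_of_contDiffOn hU hg.contDiffOn_det hp) (hg.2.2 p hp)]
  simp only [Matrix.det_fin_two]
  rw [pd_sub ((hd 0 0).fun_mul (hd 1 1)) ((hd 0 1).fun_mul (hd 1 0)), pd_mul (hd 0 0) (hd 1 1),
    pd_mul (hd 0 1) (hd 1 0)]
  simp only [LeviCivita, Matrix.inv_def, Matrix.adjugate_fin_two, Matrix.smul_apply,
    Ring.inverse_eq_inv', smul_eq_mul, Fin.sum_univ_two, Matrix.det_fin_two]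
  fin_cases k <;> simp [hsymm, hg.2.1 p hp 1 0] <;> ring

theorem MetricOn.pd_sum_leviCivita (hU : IsOpen U) (hg : MetricOn U g) {p : Fin 2 → ℝ}
    (hp : p ∈ U) :
    pd 0 (fun q => ∑ s, LeviCivita g q s s 1) p = pd 1 (fun q => ∑ s, LeviCivita g q s s 0) p := by
  have hlog : ContDiffOn ℝ ∞ (fun q => Real.log (g q).det) U := hg.contDiffOn_det.log hg.2.2
  have hc : ∀ j k, pd j (fun q => ∑ s, LeviCivita g q s s k) p =
      (1 / 2) * pd j (pd k fun q => Real.log (g q).det) p := by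
    intro j k
    rw [pd_congr hU (fun q hq => hg.sum_leviCivita hU hq k) hp,
      pd_mul (differentiableAt_const _)
        (differentiableAt_of_contDiffOn hU (contDiffOn_pd hU hlog k) hp)]
    simp [pd]
  rw [hc, hc, pd_comm hU hlog hp]

end

section

variable {U : Set (Fin 2 → ℝ)} {Γ Γ' : Christoffel 2} {φ : (Fin 2 → ℝ) → Fin 2 → ℝ}

theorem contDiffOn_ric (hU : IsOpen U) (hΓ : SmoothChristoffelOn U Γ) (i j : Fin 2) :
    ContDiffOn ℝ ∞ (fun q => ric Γ q i j) U := by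
  refine ContDiffOn.sum fun s _ => ?_
  refine ContDiffOn.sub (ContDiffOn.add (ContDiffOn.sub ?_ ?_) ?_) ?_
  · exact contDiffOn_pd hU (hΓ s i j) s
  · exact contDiffOn_pd hU (hΓ s i s) j
  · exact ContDiffOn.sum fun a _ => (hΓ a i j).mul (hΓ s a s)
  · exact ContDiffOn.sum fun a _ => (hΓ a i s).mul (hΓ s a j)

theorem ProjChange.pd_eq (hU : IsOpen U) (hΓ : SmoothChristoffelOn U Γ)
    (hφ : ∀ i, ContDiffOn ℝ ∞ (fun q => φ q i) U) (hch : ProjChange Γ Γ' φ U)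
    {p : Fin 2 → ℝ} (hp : p ∈ U) (l i j k : Fin 2) :
    pd l (fun q => Γ' q i j k) p = pd l (fun q => Γ q i j k) p
      + (if i = j then pd l (fun q => φ q k) p else 0)
      + (if i = k then pd l (fun q => φ q j) p else 0) := by
  have hdΓ := differentiableAt_of_contDiffOn hU (hΓ i j k) hp
  have hdφ := fun i => differentiableAt_of_contDiffOn hU (hφ i) hp
  have hite : ∀ (P : Prop) [Decidable P] (m : Fin 2),
      DifferentiableAt ℝ (fun q => if P then φ q m else 0) p ∧
      pd l (fun q => if P then φ q m else 0) p = if P then pd l (fun q => φ q m) p else 0 := by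
    intro P _ m
    split_ifs
    · exact ⟨hdφ m, rfl⟩
    · exact ⟨differentiableAt_const _, pd_zero l⟩
  rw [pd_congr hU (fun q hq => hch q hq i j k) hp, pd_add (hdΓ.fun_add (hite _ _).1) (hite _ _).1,
    pd_add hdΓ (hite _ _).1, (hite _ _).2, (hite _ _).2]

/-- The change of the Ricci tensor under a projective change with closed 1-form. -/
theorem ProjChange.ric_eq (hU : IsOpen U) (hΓ : SmoothChristoffelOn U Γ)
    (hsymm : ∀ q ∈ U, ∀ i j k, Γ q i j k = Γ q i k j)
    (hφ : ∀ i, ContDiffOn ℝ ∞ (fun q => φ q i) U) (hch : ProjChange Γ Γ' φ U)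
    (hclosed : ∀ q ∈ U, pd 0 (fun q => φ q 1) q = pd 1 (fun q => φ q 0) q)
    {p : Fin 2 → ℝ} (hp : p ∈ U) (i j : Fin 2) :
    ric Γ' p i j = ric Γ p i j - (pd j (fun q => φ q i) p
      - (Γ p 0 i j * φ p 0 + Γ p 1 i j * φ p 1) - φ p i * φ p j) := by
  have hc := hclosed p hp
  have hs := fun i => hsymm p hp i 1 0
  have hps := fun l i => pd_congr hU (fun q hq => hsymm q hq i 1 0) hp l
  simp only [ric, curv, Fin.sum_univ_two, hch.pd_eq hU hΓ hφ hp, hch p hp]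
  fin_cases i <;> fin_cases j <;> simp [hs, hps, hc] <;> ring

/-- The skew-symmetrised covariant derivative of the Ricci tensor is invariant under projective
changes with closed 1-form, provided the Ricci tensor is symmetric. -/
theorem ProjChange.covForm2_ric_sub_eq (hU : IsOpen U) (hΓ : SmoothChristoffelOn U Γ)
    (hsymm : ∀ q ∈ U, ∀ i j k, Γ q i j k = Γ q i k j)
    (htr : ∀ q ∈ U, pd 0 (fun q => ∑ s, Γ q s s 1) q = pd 1 (fun q => ∑ s, Γ q s s 0) q)
    (hφ : ∀ i, ContDiffOn ℝ ∞ (fun q => φ q i) U) (hch : ProjChange Γ Γ' φ U)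
    (hclosed : ∀ q ∈ U, pd 0 (fun q => φ q 1) q = pd 1 (fun q => φ q 0) q)
    {p : Fin 2 → ℝ} (hp : p ∈ U) (i : Fin 2) :
    covForm2 0 Γ' (fun q => ric Γ' q) p i 0 1 - covForm2 0 Γ' (fun q => ric Γ' q) p i 1 0 =
      covForm2 0 Γ (fun q => ric Γ q) p i 0 1 - covForm2 0 Γ (fun q => ric Γ q) p i 1 0 := by
  have hric := fun q (hq : q ∈ U) => hch.ric_eq hU hΓ hsymm hφ hclosed hq
  have hdΓ := fun i j k => differentiableAt_of_contDiffOn hU (hΓ i j k) hp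
  have hdφ := fun i => differentiableAt_of_contDiffOn hU (hφ i) hp
  have hdpφ := fun i j => differentiableAt_of_contDiffOn hU (contDiffOn_pd hU (hφ i) j) hp
  have hdric := fun i j => differentiableAt_of_contDiffOn hU (contDiffOn_ric hU hΓ i j) hp
  have hpd : ∀ i j k, pd k (fun q => ric Γ' q i j) p = pd k (fun q => ric Γ q i j) p
      - (pd k (pd j fun q => φ q i) p
        - (Γ p 0 i j * pd k (fun q => φ q 0) p + φ p 0 * pd k (fun q => Γ q 0 i j) p
          + (Γ p 1 i j * pd k (fun q => φ q 1) p + φ p 1 * pd k (fun q => Γ q 1 i j) p))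
        - (φ p i * pd k (fun q => φ q j) p + φ p j * pd k (fun q => φ q i) p)) := by
    intro i j k
    have h0 := (hdΓ 0 i j).fun_mul (hdφ 0)
    have h1 := (hdΓ 1 i j).fun_mul (hdφ 1)
    rw [pd_congr hU (fun q hq => hric q hq i j) hp,
      pd_sub (hdric i j) (((hdpφ i j).fun_sub (h0.fun_add h1)).fun_sub ((hdφ i).fun_mul (hdφ j))),
      pd_sub ((hdpφ i j).fun_sub (h0.fun_add h1)) ((hdφ i).fun_mul (hdφ j)),
      pd_sub (hdpφ i j) (h0.fun_add h1), pd_add h0 h1, pd_mul (hdΓ 0 i j) (hdφ 0),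
      pd_mul (hdΓ 1 i j) (hdφ 1), pd_mul (hdφ i) (hdφ j)]
  have hs := fun i => hsymm p hp i 1 0
  have hps := fun l i => pd_congr hU (fun q hq => hsymm q hq i 1 0) hp l
  have hc := hclosed p hp
  have hcomm := fun i => pd_comm hU (hφ i) hp 1 0
  have htp := htr p hp
  simp only [Fin.sum_univ_two] at htp
  rw [pd_add (hdΓ 0 0 1) (hdΓ 1 1 1), pd_add (hdΓ 0 0 0) (hdΓ 1 1 0), hps] at htp
  simp only [covForm2, hpd, hric p hp, Fin.sum_univ_two, hch p hp]
  simp only [ric, curv, Fin.sum_univ_two]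
  fin_cases i <;> simp [hs, hps, hc, hcomm]
  · linear_combination φ p 0 * htp
  · linear_combination φ p 1 * htp

theorem ProjChange.closed_of_trace (hU : IsOpen U) (hΓ : SmoothChristoffelOn U Γ)
    (hφ : ∀ i, ContDiffOn ℝ ∞ (fun q => φ q i) U) (hch : ProjChange Γ Γ' φ U)
    (htr : ∀ q ∈ U, pd 0 (fun q => ∑ s, Γ q s s 1) q = pd 1 (fun q => ∑ s, Γ q s s 0) q)
    (htr' : ∀ q ∈ U, pd 0 (fun q => ∑ s, Γ' q s s 1) q = pd 1 (fun q => ∑ s, Γ' q s s 0) q) :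
    ∀ q ∈ U, pd 0 (fun q => φ q 1) q = pd 1 (fun q => φ q 0) q := by
  intro q hq
  have hc : ∀ l k, pd l (fun q => ∑ s, Γ' q s s k) q =
      pd l (fun q => ∑ s, Γ q s s k) q + 3 * pd l (fun q => φ q k) q := by
    intro l k
    have hsum : ∀ r ∈ U, ∑ s, Γ' r s s k = (∑ s, Γ r s s k) + 3 * φ r k := by
      intro r hr
      simp only [Fin.sum_univ_two, hch r hr]
      fin_cases k <;> simp <;> ring
    have hdφ := differentiableAt_of_contDiffOn hU (hφ k) hq
    rw [pd_congr hU hsum hq, pd_add (differentiableAt_of_contDiffOn hU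
      (ContDiffOn.sum fun s _ => hΓ s s k) hq) (hdφ.const_mul 3),
      pd_mul (differentiableAt_const _) hdφ]
    simp [pd]
  have hbar := htr' q hq
  rw [hc, hc, htr q hq] at hbar
  linarith

/-- Projectively equivalent symmetric connections in dimension two differ by a projective change
with smooth 1-form. -/
theorem exists_projChange (hU : IsOpen U) (hΓ : SmoothChristoffelOn U Γ)
    (hΓ' : SmoothChristoffelOn U Γ') (hsymm : ∀ q ∈ U, ∀ i j k, Γ q i j k = Γ q i k j)
    (hsymm' : ∀ q ∈ U, ∀ i j k, Γ' q i j k = Γ' q i k j) (h : ProjEquivOn U Γ Γ') :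
    ∃ φ : (Fin 2 → ℝ) → Fin 2 → ℝ,
      (∀ i, ContDiffOn ℝ ∞ (fun q => φ q i) U) ∧ ProjChange Γ Γ' φ U := by
  refine ⟨fun q => ![Γ' q 1 0 1 - Γ q 1 0 1, Γ' q 0 0 1 - Γ q 0 0 1], fun i => ?_, ?_⟩
  · fin_cases i
    · exact (hΓ' 1 0 1).sub (hΓ 1 0 1)
    · exact (hΓ' 0 0 1).sub (hΓ 0 0 1)
  · intro p hp
    have hs := fun i => hsymm p hp i 1 0
    have hs' := fun i => hsymm' p hp i 1 0
    obtain ⟨h0, h1, h2, h3⟩ := projective_form_of_forall_smul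
      (D := fun i j k => Γ' p i j k - Γ p i j k) (fun i => by rw [hs, hs'])
      (exists_christoffel_diff_eq_smul hU hΓ h hp)
    intro i j k
    fin_cases i <;> fin_cases j <;> fin_cases k <;> simp [hs, hs'] <;> linarith

end

/-- **Liouville.** For two projectively equivalent Riemannian metrics on a
2-dimensional domain, the tensor `L_{ijk} = R_{ij,k} − R_{ik,j}` is the same; i.e. the
Liouville tensor is, in the metric case, a tensor invariant of the projective structure. -/
theorem statement_14 (U : Set (Fin 2 → ℝ)) (hU : IsOpen U)
    (g gbar : (Fin 2 → ℝ) → Matrix (Fin 2) (Fin 2) ℝ)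
    (hg : RiemannianOn U g) (hgbar : RiemannianOn U gbar)
    (hproj : ProjEquivOn U (LeviCivita g) (LeviCivita gbar)) :
    ∀ p ∈ U, ∀ i j k, liouville gbar p i j k = liouville g p i j k := by
  have hs := hg.1.smooth_leviCivita hU
  have hs' := hgbar.1.smooth_leviCivita hU
  obtain ⟨φ, hφ, hch⟩ := exists_projChange hU hs hs'
    (fun q hq => hg.1.leviCivita_symm hU hq) (fun q hq => hgbar.1.leviCivita_symm hU hq) hproj
  have htr := fun q (hq : q ∈ U) => hg.1.pd_sum_leviCivita hU hq
  have htr' := fun q (hq : q ∈ U) => hgbar.1.pd_sum_leviCivita hU hq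
  have hclosed := hch.closed_of_trace hU hs hφ htr htr'
  intro p hp i j k
  have key := hch.covForm2_ric_sub_eq hU hs (fun q hq => hg.1.leviCivita_symm hU hq) htr hφ
    hclosed hp i
  simp only [liouville]
  fin_cases j <;> fin_cases k
  · simp
  · exact key
  · simp only [Fin.mk_one, Fin.zero_eta]
    linear_combination -key
  · simp

end ProjGeo
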